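/- Let ℓ > 0. Let K_q ∈ C¹([0,ℓ]) and K_p ∈ C⁰([0,ℓ]) be symmetric positive-definite 2×2 matrix fields, and let K_v : [0,ℓ]×[0,∞) → ℝ^{2×2} be continuous symmetric with κI ⪯ K_v(s,t) ⪯ ΚI for some 0 < κ ≤ Κ. Let Φ : [0,ℓ]×[0,∞) → ℝ^{2×2} be C¹ symmetric-valued and Ψ : [0,ℓ]×[0,∞) → ℝ² continuous, and suppose there exist M, β > 0 such that sup_s (‖Φ(s,t)‖ + ‖Φ_t(s,t)‖) ≤ M e^{−βt} and ‖Ψ(·,t)‖_{L²} ≤ M e^{−βt} for all t. Suppose there is μ > 0 with (K_q(s) + Φ(s,t)) ⪰ μI for all (s,t). Let p̃ : [0,ℓ]×[0,∞) → ℝ² be a C² solution of p̃_tt = ((K_q + Φ) p̃_s)_s − K_v p̃_t − K_p p̃ + Ψ with boundary conditions p̃(0,t) = 0 and p̃_s(ℓ,t) = 0. Then there exist C > 0 and λ > 0 such that ‖p̃(·,t)‖_{L²} + ‖p̃_t(·,t)‖_{L²} + ‖p̃_s(·,t)‖_{L²} ≤ C e^{−λt} for all t ≥ 0. -/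

import Mathlib

open Matrix

/-- The operator (`ℓ² → ℓ²`) norm of a `2 × 2` real matrix. -/
noncomputable def opNorm (A : Matrix (Fin 2) (Fin 2) ℝ) : ℝ :=
  ‖LinearMap.toContinuousLinearMap (Matrix.toEuclideanLin A)‖

/-- The `L²` norm of an `ℝ²`-valued function on `[0, ℓ]`. -/
noncomputable def L2vnorm (ℓ : ℝ) (f : ℝ → Fin 2 → ℝ) : ℝ :=
  Real.sqrt (∫ s in (0:ℝ)..ℓ, ((f s 0) ^ 2 + (f s 1) ^ 2))

open Set MeasureTheory

/-! ### Matrices -/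

theorem dotProduct_mulVec_le_opNorm (A : Matrix (Fin 2) (Fin 2) ℝ) (v : Fin 2 → ℝ) :
    v ⬝ᵥ A *ᵥ v ≤ opNorm A * (v ⬝ᵥ v) := by
  have h1 := real_inner_le_norm (WithLp.toLp 2 v) (Matrix.toEuclideanLin A (WithLp.toLp 2 v))
  have h2 : ‖Matrix.toEuclideanLin A (WithLp.toLp 2 v)‖ ≤ opNorm A * ‖WithLp.toLp 2 v‖ :=
    (LinearMap.toContinuousLinearMap (Matrix.toEuclideanLin A)).le_opNorm (WithLp.toLp 2 v)
  have h3 : ‖WithLp.toLp 2 v‖ * ‖WithLp.toLp 2 v‖ = v ⬝ᵥ v := by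
    rw [← real_inner_self_eq_norm_mul_norm, EuclideanSpace.inner_toLp_toLp]; simp
  have h4 : inner ℝ (WithLp.toLp 2 v) (Matrix.toEuclideanLin A (WithLp.toLp 2 v))
      = v ⬝ᵥ A *ᵥ v := by
    rw [Matrix.toLpLin_toLp, EuclideanSpace.inner_toLp_toLp]; simp [dotProduct_comm]
  calc v ⬝ᵥ A *ᵥ v ≤ ‖WithLp.toLp 2 v‖ * (opNorm A * ‖WithLp.toLp 2 v‖) :=
        (h4 ▸ h1).trans (mul_le_mul_of_nonneg_left h2 (norm_nonneg _))
    _ = opNorm A * (v ⬝ᵥ v) := by rw [← h3]; ring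

theorem Matrix.PosSemidef.dotProduct_mulVec_self_nonneg {A : Matrix (Fin 2) (Fin 2) ℝ}
    (hA : A.PosSemidef) (v : Fin 2 → ℝ) : 0 ≤ v ⬝ᵥ A *ᵥ v := by
  simpa using hA.dotProduct_mulVec_nonneg v

theorem dotProduct_self_eq_sq_add_sq (v : Fin 2 → ℝ) : v ⬝ᵥ v = v 0 ^ 2 + v 1 ^ 2 := by
  simp [dotProduct, Fin.sum_univ_two, sq]

theorem dotProduct_self_nonneg_real (v : Fin 2 → ℝ) : 0 ≤ v ⬝ᵥ v := by
  rw [dotProduct_self_eq_sq_add_sq]; positivity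

theorem smul_one_le_dotProduct_mulVec {A : Matrix (Fin 2) (Fin 2) ℝ} {c : ℝ}
    (h : (A - c • (1 : Matrix (Fin 2) (Fin 2) ℝ)).PosSemidef) (v : Fin 2 → ℝ) :
    c * (v ⬝ᵥ v) ≤ v ⬝ᵥ A *ᵥ v := by
  have := h.dotProduct_mulVec_self_nonneg v
  rw [sub_mulVec, smul_mulVec, one_mulVec, dotProduct_sub, dotProduct_smul, smul_eq_mul] at this
  linarith

theorem dotProduct_mulVec_le_smul_one {A : Matrix (Fin 2) (Fin 2) ℝ} {c : ℝ}
    (h : (c • (1 : Matrix (Fin 2) (Fin 2) ℝ) - A).PosSemidef) (v : Fin 2 → ℝ) :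
    v ⬝ᵥ A *ᵥ v ≤ c * (v ⬝ᵥ v) := by
  have := h.dotProduct_mulVec_self_nonneg v
  rw [sub_mulVec, smul_mulVec, one_mulVec, dotProduct_sub, dotProduct_smul, smul_eq_mul] at this
  linarith

/-- Young's inequality for the dot product. -/
theorem abs_dotProduct_le (u v : Fin 2 → ℝ) {η : ℝ} (hη : 0 < η) :
    |u ⬝ᵥ v| ≤ η / 2 * (u ⬝ᵥ u) + 1 / (2 * η) * (v ⬝ᵥ v) := by
  have h1 := dotProduct_self_nonneg_real (η • u + v)
  have h2 := dotProduct_self_nonneg_real (η • u - v)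
  simp only [dotProduct, Fin.sum_univ_two, Pi.add_apply, Pi.sub_apply, Pi.smul_apply,
    smul_eq_mul] at *
  rw [abs_le]
  have key : η / 2 * (u 0 * u 0 + u 1 * u 1) + 1 / (2 * η) * (v 0 * v 0 + v 1 * v 1)
      = (η ^ 2 * (u 0 * u 0 + u 1 * u 1) + (v 0 * v 0 + v 1 * v 1)) / (2 * η) := by
    field_simp
  rw [key]
  constructor
  · rw [neg_le, le_div_iff₀ (by positivity)]; linarith
  · rw [le_div_iff₀ (by positivity)]; linarith

/-- Young's inequality for a positive semidefinite form. -/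
theorem neg_dotProduct_mulVec_le {A : Matrix (Fin 2) (Fin 2) ℝ} (hs : A.IsSymm)
    (hA : ∀ w, 0 ≤ w ⬝ᵥ A *ᵥ w) (u v : Fin 2 → ℝ) {η : ℝ} (hη : 0 < η) :
    -(u ⬝ᵥ A *ᵥ v) ≤ η / 2 * (u ⬝ᵥ A *ᵥ u) + 1 / (2 * η) * (v ⬝ᵥ A *ᵥ v) := by
  have h := hA (η • u + v)
  have h10 := hs.apply 0 1
  simp only [dotProduct, mulVec, Fin.sum_univ_two, Pi.add_apply, Pi.smul_apply,
    smul_eq_mul, h10] at *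
  set a := u 0 * (A 0 0 * u 0 + A 0 1 * u 1) + u 1 * (A 0 1 * u 0 + A 1 1 * u 1)
  set b := v 0 * (A 0 0 * v 0 + A 0 1 * v 1) + v 1 * (A 0 1 * v 0 + A 1 1 * v 1)
  have key : η / 2 * a + 1 / (2 * η) * b = (η ^ 2 * a + b) / (2 * η) := by field_simp
  rw [key, le_div_iff₀ (by positivity)]
  simp only [a, b]
  linarith

/-! ### Calculus of dot products -/

theorem HasDerivWithinAt.dotProduct_fin_two {f g : ℝ → Fin 2 → ℝ} {f' g' : Fin 2 → ℝ} {S : Set ℝ}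
    {x : ℝ} (hf : HasDerivWithinAt f f' S x) (hg : HasDerivWithinAt g g' S x) :
    HasDerivWithinAt (fun y => f y ⬝ᵥ g y) (f' ⬝ᵥ g x + f x ⬝ᵥ g') S x := by
  rw [hasDerivWithinAt_pi] at hf hg
  simp only [dotProduct, Fin.sum_univ_two]
  exact (((hf 0).mul (hg 0)).add ((hf 1).mul (hg 1))).congr_deriv (by ring)

theorem HasDerivWithinAt.mulVec_fin_two {A : ℝ → Matrix (Fin 2) (Fin 2) ℝ}
    {A' : Matrix (Fin 2) (Fin 2) ℝ} {v : ℝ → Fin 2 → ℝ} {v' : Fin 2 → ℝ} {S : Set ℝ} {x : ℝ}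
    (hA : ∀ i j, HasDerivWithinAt (fun y => A y i j) (A' i j) S x)
    (hv : HasDerivWithinAt v v' S x) :
    HasDerivWithinAt (fun y => A y *ᵥ v y) (A' *ᵥ v x + A x *ᵥ v') S x := by
  rw [hasDerivWithinAt_pi] at hv ⊢
  intro i
  simp only [mulVec, dotProduct, Fin.sum_univ_two, Pi.add_apply]
  exact (((hA i 0).mul (hv 0)).add ((hA i 1).mul (hv 1))).congr_deriv (by ring)

theorem ContinuousOn.dotProduct_fin_two {X : Type*} [TopologicalSpace X] {f g : X → Fin 2 → ℝ}
    {S : Set X} (hf : ContinuousOn f S) (hg : ContinuousOn g S) :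
    ContinuousOn (fun x => f x ⬝ᵥ g x) S := by
  rw [continuousOn_iff_continuous_domRestrict] at *
  exact hf.dotProduct hg

theorem ContinuousOn.mulVec_fin_two {X : Type*} [TopologicalSpace X]
    {A : X → Matrix (Fin 2) (Fin 2) ℝ} {v : X → Fin 2 → ℝ}
    {S : Set X} (hA : ContinuousOn A S) (hv : ContinuousOn v S) :
    ContinuousOn (fun x => A x *ᵥ v x) S := by
  rw [continuousOn_iff_continuous_domRestrict] at *
  exact hA.matrix_mulVec hv

/-! ### Integrals depending on a parameter -/

theorem ContinuousOn.intervalIntegral_strip {ℓ : ℝ} (hℓ : 0 ≤ ℓ) {f : ℝ → ℝ → ℝ}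
    (hf : ContinuousOn (fun z : ℝ × ℝ => f z.1 z.2) (Icc 0 ℓ ×ˢ Ici 0)) :
    ContinuousOn (fun t => ∫ s in (0:ℝ)..ℓ, f s t) (Ici 0) := by
  have hc : Continuous fun z : ℝ × ℝ => f (max 0 (min z.2 ℓ)) (max 0 z.1) :=
    hf.comp_continuous (f := fun z : ℝ × ℝ => (max 0 (min z.2 ℓ), max 0 z.1)) (by fun_prop)
      fun z => ⟨⟨le_max_left _ _, max_le hℓ (min_le_right _ _)⟩, le_max_left (0:ℝ) z.1⟩
  have := intervalIntegral.continuous_parametric_intervalIntegral_of_continuous'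
    (μ := volume) (f := fun t s => f (max 0 (min s ℓ)) (max 0 t)) hc 0 ℓ
  refine this.continuousOn.congr fun t ht => intervalIntegral.integral_congr fun s hs => ?_
  rw [uIcc_of_le hℓ] at hs
  simp only [min_eq_left hs.2, max_eq_right hs.1, max_eq_right (mem_Ici.1 ht)]

theorem ContinuousOn.slice_strip {ℓ t : ℝ} (ht : 0 ≤ t) {E : Type*} [TopologicalSpace E]
    {f : ℝ → ℝ → E}
    (hf : ContinuousOn (fun z : ℝ × ℝ => f z.1 z.2) (Icc 0 ℓ ×ˢ Ici 0)) :
    ContinuousOn (fun s => f s t) (Icc 0 ℓ) :=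
  hf.comp (f := fun s : ℝ => (s, t)) (by fun_prop) fun _ hs => ⟨hs, ht⟩

theorem hasDerivAt_intervalIntegral_strip {ℓ : ℝ} (hℓ : 0 ≤ ℓ) {f f' : ℝ → ℝ → ℝ}
    (hf : ContinuousOn (fun z : ℝ × ℝ => f z.1 z.2) (Icc 0 ℓ ×ˢ Ici 0))
    (hf' : ContinuousOn (fun z : ℝ × ℝ => f' z.1 z.2) (Icc 0 ℓ ×ˢ Ici 0))
    (hd : ∀ t ∈ Ici (0:ℝ), ∀ s ∈ Icc (0:ℝ) ℓ,
      HasDerivWithinAt (fun τ => f s τ) (f' s t) (Ici 0) t) {t : ℝ} (ht : 0 < t) :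
    HasDerivAt (fun t => ∫ s in (0:ℝ)..ℓ, f s t) (∫ s in (0:ℝ)..ℓ, f' s t) t := by
  obtain ⟨C, hC⟩ := (isCompact_Icc.prod isCompact_Icc).exists_bound_of_continuousOn
    (hf'.mono (prod_mono_right (Icc_subset_Ici_self : Icc 0 (t + 1) ⊆ Ici 0)))
  have hsub : uIoc 0 ℓ ⊆ Icc 0 ℓ := by rw [uIoc_of_le hℓ]; exact Ioc_subset_Icc_self
  have hii : ∀ {g : ℝ → ℝ → ℝ},
      ContinuousOn (fun z : ℝ × ℝ => g z.1 z.2) (Icc 0 ℓ ×ˢ Ici 0) → ∀ τ, 0 ≤ τ →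
      IntervalIntegrable (fun s => g s τ) volume 0 ℓ := fun hg τ hτ =>
    (hg.slice_strip hτ).intervalIntegrable_of_Icc hℓ
  refine (intervalIntegral.hasDerivAt_integral_of_dominated_loc_of_deriv_le
    (F := fun τ s => f s τ) (F' := fun τ s => f' s τ) (bound := fun _ => C)
    (Ioo_mem_nhds ht (lt_add_one t)) ?_ (hii hf t ht.le)
    (hii hf' t ht.le).def'.aestronglyMeasurable ?_ intervalIntegrable_const ?_).2
  · filter_upwards [lt_mem_nhds ht] with τ hτ
    exact (hii hf τ hτ.le).def'.aestronglyMeasurable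
  · exact ae_of_all _ fun s hs τ hτ => hC (s, τ) ⟨hsub hs, hτ.1.le, hτ.2.le⟩
  · exact ae_of_all _ fun s hs τ hτ =>
      (hd τ hτ.1.le s (hsub hs)).hasDerivAt (Ici_mem_nhds hτ.1)

theorem integral_eq_zero_of_hasDerivWithinAt_Icc {ℓ : ℝ} (hℓ : 0 ≤ ℓ) {f f' : ℝ → ℝ}
    (hd : ∀ s ∈ Icc (0:ℝ) ℓ, HasDerivWithinAt f (f' s) (Icc 0 ℓ) s)
    (hc : ContinuousOn f' (Icc 0 ℓ)) (h0 : f 0 = 0) (h1 : f ℓ = 0) :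
    ∫ s in (0:ℝ)..ℓ, f' s = 0 := by
  rw [intervalIntegral.integral_eq_sub_of_hasDerivAt_of_le hℓ
    (fun s hs => (hd s hs).continuousWithinAt)
    (fun s hs => (hd s (Ioo_subset_Icc_self hs)).hasDerivAt (Icc_mem_nhds hs.1 hs.2))
    (hc.intervalIntegrable_of_Icc hℓ), h0, h1, sub_zero]

/-! ### A Grönwall estimate with exponentially vanishing perturbations -/

theorem exists_exp_decay_of_deriv_le {V V' : ℝ → ℝ} {a b c β : ℝ} (ha : 0 < a) (hb : 0 ≤ b)
    (hc : 0 ≤ c) (hβ : 0 < β) (hV : ContinuousOn V (Ici 0)) (hV0 : ∀ t, 0 ≤ t → 0 ≤ V t)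
    (hd : ∀ t, 0 < t → HasDerivAt V (V' t) t)
    (hle : ∀ t, 0 < t →
      V' t ≤ -a * V t + b * Real.exp (-β * t) * V t + c * Real.exp (-β * t)) :
    ∃ C > 0, ∃ lam > 0, ∀ t, 0 ≤ t → V t ≤ C * Real.exp (-lam * t) := by
  obtain ⟨lam, hlam, hla, hlβ⟩ : ∃ lam > 0, lam ≤ a ∧ lam ≤ β / 2 :=
    ⟨min a (β / 2), by positivity, min_le_left _ _, min_le_right _ _⟩
  set g : ℝ → ℝ := fun t => lam * t + b / β * Real.exp (-β * t) with hg
  set D : ℝ := c * Real.exp (b / β) with hD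
  have hD0 : 0 ≤ D := by positivity
  set U : ℝ → ℝ := fun t => V t * Real.exp (g t) + D / (β / 2) * Real.exp (-(β / 2) * t) with hU
  have hexp : ∀ (k t : ℝ), HasDerivAt (fun t => Real.exp (k * t)) (k * Real.exp (k * t)) t :=
    fun k t => (((hasDerivAt_id t).const_mul k).exp).congr_deriv (by simp [mul_comm])
  have hgd : ∀ t, HasDerivAt g (lam - b * Real.exp (-β * t)) t := fun t =>
    (((hasDerivAt_id t).const_mul lam).add ((hexp (-β) t).const_mul (b / β))).congr_deriv
      (by field_simp; ring)
  have hanti : AntitoneOn U (Ici 0) := by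
    refine antitoneOn_of_hasDerivWithinAt_nonpos (convex_Ici 0) (f' := fun t =>
      V' t * Real.exp (g t) + V t * (Real.exp (g t) * (lam - b * Real.exp (-β * t)))
        + D / (β / 2) * (-(β / 2) * Real.exp (-(β / 2) * t))) ?_ ?_ ?_
    · have : Continuous g := continuous_iff_continuousAt.2 fun t => (hgd t).continuousAt
      fun_prop
    · intro t ht
      rw [interior_Ici] at ht
      exact (((hd t ht).mul (hgd t).exp).add ((hexp _ t).const_mul _)).hasDerivWithinAt
    · intro t ht
      rw [interior_Ici] at ht
      have ht : 0 < t := ht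
      have h1 : D / (β / 2) * (-(β / 2) * Real.exp (-(β / 2) * t))
          = -(c * (Real.exp (b / β) * Real.exp (-(β / 2) * t))) := by
        rw [hD]; field_simp
      have h2 : Real.exp (-β * t) * Real.exp (g t)
          ≤ Real.exp (b / β) * Real.exp (-(β / 2) * t) := by
        rw [← Real.exp_add, ← Real.exp_add, Real.exp_le_exp]
        have : b / β * Real.exp (-β * t) ≤ b / β * 1 :=
          mul_le_mul_of_nonneg_left (Real.exp_le_one_iff.2 (by nlinarith)) (by positivity)
        simp only [hg]
        nlinarith
      have h3 := mul_le_mul_of_nonneg_right (hle t ht) (Real.exp_pos (g t)).le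
      have h4 := mul_le_mul_of_nonneg_left h2 hc
      have h5 : 0 ≤ (a - lam) * (V t * Real.exp (g t)) :=
        mul_nonneg (sub_nonneg.2 hla) (mul_nonneg (hV0 t ht.le) (Real.exp_pos _).le)
      rw [h1]
      nlinarith
  refine ⟨U 0 + 1, ?_, lam, hlam, fun t ht => ?_⟩
  · have : 0 ≤ U 0 := add_nonneg (mul_nonneg (hV0 0 le_rfl) (Real.exp_pos _).le) (by positivity)
    linarith
  · have h1 : U t ≤ U 0 := hanti (mem_Ici.2 le_rfl) (mem_Ici.2 ht) ht
    have h2 : V t * Real.exp (lam * t) ≤ V t * Real.exp (g t) := by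
      refine mul_le_mul_of_nonneg_left (Real.exp_le_exp.2 ?_) (hV0 t ht)
      simp only [hg]
      have : 0 ≤ b / β * Real.exp (-β * t) := by positivity
      linarith
    have h3 : 0 ≤ D / (β / 2) * Real.exp (-(β / 2) * t) := by positivity
    have h4 : V t * Real.exp (lam * t) ≤ U 0 + 1 := by simp only [hU] at h1 ⊢; linarith
    rw [neg_mul, Real.exp_neg, ← div_eq_mul_inv]
    exact (le_div_iff₀ (Real.exp_pos _)).2 h4

/-! ### Pointwise inequalities for the energy densities -/

/-- The energy dissipation estimate at one point. Here `u, r, v, w, a` stand for the values of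
`p, p_s, p_t, p_st, p_tt`, and `D` for the value of `∂_s ((s - ℓ) |p|²)`. -/
theorem energy_dissipation_pointwise {A B Kp Kv : Matrix (Fin 2) (Fin 2) ℝ}
    {u r v w a q ψ : Fin 2 → ℝ} {κ κ' P ε D m : ℝ} (hκ : 0 < κ) (hκ' : 0 < κ') (hP : 0 < P)
    (hε : 0 < ε) (hεκ : ε ≤ κ / 8) (hεP : 2 * ε * κ' * P ≤ 1)
    (hA : A.IsSymm) (hKp : Kp.IsSymm) (hKv : Kv.IsSymm)
    (hKvlb : ∀ x, κ * (x ⬝ᵥ x) ≤ x ⬝ᵥ Kv *ᵥ x) (hKvub : ∀ x, x ⬝ᵥ Kv *ᵥ x ≤ κ' * (x ⬝ᵥ x))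
    (hKp0 : 0 ≤ u ⬝ᵥ Kp *ᵥ u) (hB : r ⬝ᵥ B *ᵥ r ≤ m * (r ⬝ᵥ A *ᵥ r)) (hm : 0 ≤ m)
    (hu : u ⬝ᵥ u ≤ 2 * D + P * (r ⬝ᵥ A *ᵥ r))
    (hpde : a = q - Kv *ᵥ v - Kp *ᵥ u + ψ) :
    1 / 2 * ((a ⬝ᵥ v + v ⬝ᵥ a) + (w ⬝ᵥ A *ᵥ r + r ⬝ᵥ (B *ᵥ r + A *ᵥ w))
        + (v ⬝ᵥ Kp *ᵥ u + u ⬝ᵥ Kp *ᵥ v)) + ε * (v ⬝ᵥ v + u ⬝ᵥ a)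
      ≤ (-ε + m) * (1 / 2 * (v ⬝ᵥ v + r ⬝ᵥ A *ᵥ r + u ⬝ᵥ Kp *ᵥ u))
        + (2 / κ + ε * P) * (ψ ⬝ᵥ ψ)
        + (((w + ε • r) ⬝ᵥ A *ᵥ r + (v + ε • u) ⬝ᵥ q) + ε / P * D) := by
  have hid : 1 / 2 * ((a ⬝ᵥ v + v ⬝ᵥ a) + (w ⬝ᵥ A *ᵥ r + r ⬝ᵥ (B *ᵥ r + A *ᵥ w))
        + (v ⬝ᵥ Kp *ᵥ u + u ⬝ᵥ Kp *ᵥ v)) + ε * (v ⬝ᵥ v + u ⬝ᵥ a)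
      = ((w + ε • r) ⬝ᵥ A *ᵥ r + (v + ε • u) ⬝ᵥ q) - v ⬝ᵥ Kv *ᵥ v + v ⬝ᵥ ψ
        + 1 / 2 * (r ⬝ᵥ B *ᵥ r)
        + ε * (v ⬝ᵥ v - r ⬝ᵥ A *ᵥ r - u ⬝ᵥ Kv *ᵥ v - u ⬝ᵥ Kp *ᵥ u + u ⬝ᵥ ψ) := by
    have h1 := hA.apply 0 1
    have h2 := hKp.apply 0 1
    subst hpde
    simp only [dotProduct, mulVec, Fin.sum_univ_two, Pi.add_apply, Pi.sub_apply, Pi.smul_apply,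
      smul_eq_mul, h1, h2]
    ring
  rw [hid]
  have hKv0 : ∀ x, 0 ≤ x ⬝ᵥ Kv *ᵥ x := fun x =>
    (mul_nonneg hκ.le (dotProduct_self_nonneg_real x)).trans (hKvlb x)
  have y1 := neg_dotProduct_mulVec_le hKv hKv0 u v (η := 1 / (2 * κ' * P)) (by positivity)
  have y2 := (le_abs_self _).trans (abs_dotProduct_le u ψ (η := 1 / (2 * P)) (by positivity))
  have y3 := (le_abs_self _).trans (abs_dotProduct_le v ψ (η := κ / 4) (by positivity))
  have hv := dotProduct_self_nonneg_real v
  have e1 : 1 / (2 * (1 / (2 * κ' * P))) = κ' * P := by field_simp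
  have e2 : 1 / (2 * (1 / (2 * P))) = P := by field_simp
  have e3 : 1 / (2 * (κ / 4)) = 2 / κ := by field_simp; norm_num
  have e4 : 1 / (2 * κ' * P) / 2 * (κ' * (u ⬝ᵥ u)) = 1 / (2 * P) / 2 * (u ⬝ᵥ u) := by field_simp
  have y4 := mul_le_mul_of_nonneg_left (hKvub u)
    (show 0 ≤ 1 / (2 * κ' * P) / 2 by positivity)
  rw [e1] at y1
  rw [e2] at y2
  rw [e3] at y3
  rw [e4] at y4
  have y5 : 2 * (1 / (2 * P) / 2 * (u ⬝ᵥ u)) ≤ D / P + 1 / 2 * (r ⬝ᵥ A *ᵥ r) := by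
    have := mul_le_mul_of_nonneg_left hu (show 0 ≤ 1 / (2 * P) by positivity)
    calc _ = 1 / (2 * P) * (u ⬝ᵥ u) := by ring
      _ ≤ _ := this
      _ = _ := by field_simp
  have y6 : ε * (-(u ⬝ᵥ Kv *ᵥ v) + u ⬝ᵥ ψ)
      ≤ ε * (D / P + 1 / 2 * (r ⬝ᵥ A *ᵥ r) + κ' * P * (v ⬝ᵥ Kv *ᵥ v) + P * (ψ ⬝ᵥ ψ)) :=
    mul_le_mul_of_nonneg_left (by linarith) hε.le
  have y7 := mul_le_mul_of_nonneg_right hεP (hKv0 v)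
  have y8 := mul_le_mul_of_nonneg_right hεκ hv
  have y9 := hKvlb v
  have y13 := mul_nonneg hκ.le hv
  have y10 := mul_nonneg hm hv
  have y11 := mul_nonneg hm hKp0
  have y12 := mul_nonneg hε.le hKp0
  have e5 : ε / P * D = ε * (D / P) := by ring
  have e6 : κ / 4 / 2 * (v ⬝ᵥ v) = κ / 8 * (v ⬝ᵥ v) := by ring
  rw [e5]
  rw [e6] at y3
  linarith

/-- The energy density and its perturbation by the cross term are equivalent modulo the null
Lagrangian `D`. -/
theorem energy_equiv_pointwise {u v : Fin 2 → ℝ} {b c P ε D : ℝ} (hb : 0 ≤ b) (hc : 0 ≤ c)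
    (hε : 0 < ε) (hε2 : ε ≤ 1 / 2) (hεP : ε * P ≤ 1 / 2) (hu : u ⬝ᵥ u ≤ 2 * D + P * b) :
    1 / 2 * (1 / 2 * (v ⬝ᵥ v + b + c))
        ≤ (1 / 2 * (v ⬝ᵥ v + b + c) + ε * (u ⬝ᵥ v)) + ε * D ∧
      1 / 2 * (v ⬝ᵥ v + b + c) + ε * (u ⬝ᵥ v)
        ≤ 3 / 2 * (1 / 2 * (v ⬝ᵥ v + b + c)) + ε * D := by
  have h := abs_le.1 (abs_dotProduct_le u v one_pos)
  have hv := dotProduct_self_nonneg_real v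
  have h1 := mul_le_mul_of_nonneg_left hu hε.le
  have h2 := mul_le_mul_of_nonneg_left h.1 hε.le
  have h3 := mul_le_mul_of_nonneg_left h.2 hε.le
  have h4 := mul_le_mul_of_nonneg_right hε2 hv
  have h5 := mul_le_mul_of_nonneg_right hεP hb
  constructor <;> linarith

/-- The pointwise form of Poincaré's inequality for `p(0) = 0`. -/
theorem poincare_pointwise (u r : Fin 2 → ℝ) {s ℓ : ℝ} (h0 : 0 ≤ s) (h1 : s ≤ ℓ) :
    u ⬝ᵥ u ≤ 2 * (u ⬝ᵥ u + (s - ℓ) * (r ⬝ᵥ u + u ⬝ᵥ r)) + 4 * ℓ ^ 2 * (r ⬝ᵥ r) := by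
  have h := dotProduct_self_nonneg_real (u + (2 * (s - ℓ)) • r)
  have h2 : 0 ≤ (ℓ ^ 2 - (s - ℓ) ^ 2) * (r ⬝ᵥ r) :=
    mul_nonneg (by nlinarith) (dotProduct_self_nonneg_real r)
  simp only [dotProduct, Fin.sum_univ_two, Pi.add_apply, Pi.smul_apply, smul_eq_mul] at *
  linarith

/-- outer-loop exponential convergence: the translational error system
`p̃_tt = ((K_q + Φ)p̃_s)_s − K_vp̃_t − K_pp̃ + Ψ`, with exponentially vanishing
perturbations `Φ, Ψ`, uniform ellipticity `K_q + Φ ⪰ μI`, and boundary conditions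
`p̃(0,t) = 0`, `p̃_s(ℓ,t) = 0`, decays exponentially in `L²`. -/
theorem stmt_15 (ℓ : ℝ) (hℓ : 0 < ℓ)
    (Kq Kq' : ℝ → Matrix (Fin 2) (Fin 2) ℝ)
    (Kp : ℝ → Matrix (Fin 2) (Fin 2) ℝ)
    (Kv Φ Φt : ℝ → ℝ → Matrix (Fin 2) (Fin 2) ℝ)
    (Ψ : ℝ → ℝ → Fin 2 → ℝ)
    (κ κ' M β μ : ℝ) (hκ : 0 < κ) (hκκ' : κ ≤ κ') (hM : 0 < M) (hβ : 0 < β) (hμ : 0 < μ)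
    -- K_q ∈ C¹ symmetric positive definite
    (hKq' : ∀ s ∈ Set.Icc (0:ℝ) ℓ, ∀ i j,
      HasDerivWithinAt (fun x => Kq x i j) (Kq' s i j) (Set.Icc 0 ℓ) s)
    (hKq'c : ContinuousOn Kq' (Set.Icc 0 ℓ))
    (hKqsym : ∀ s ∈ Set.Icc (0:ℝ) ℓ, (Kq s).IsSymm)
    (hKqpd : ∀ s ∈ Set.Icc (0:ℝ) ℓ, (Kq s).PosDef)
    -- K_p ∈ C⁰ symmetric positive definite
    (hKpc : ContinuousOn Kp (Set.Icc 0 ℓ))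
    (hKpsym : ∀ s ∈ Set.Icc (0:ℝ) ℓ, (Kp s).IsSymm)
    (hKppd : ∀ s ∈ Set.Icc (0:ℝ) ℓ, (Kp s).PosDef)
    -- K_v continuous symmetric with κI ⪯ K_v ⪯ κ'I
    (hKvc : ContinuousOn (fun z : ℝ × ℝ => Kv z.1 z.2) (Set.Icc 0 ℓ ×ˢ Set.Ici 0))
    (hKvsym : ∀ s ∈ Set.Icc (0:ℝ) ℓ, ∀ t ∈ Set.Ici (0:ℝ), (Kv s t).IsSymm)
    (hKvlb : ∀ s ∈ Set.Icc (0:ℝ) ℓ, ∀ t ∈ Set.Ici (0:ℝ),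
      (Kv s t - κ • (1 : Matrix (Fin 2) (Fin 2) ℝ)).PosSemidef)
    (hKvub : ∀ s ∈ Set.Icc (0:ℝ) ℓ, ∀ t ∈ Set.Ici (0:ℝ),
      (κ' • (1 : Matrix (Fin 2) (Fin 2) ℝ) - Kv s t).PosSemidef)
    -- Φ is C¹ (in t) symmetric-valued, Ψ continuous
    (hΦsym : ∀ s ∈ Set.Icc (0:ℝ) ℓ, ∀ t ∈ Set.Ici (0:ℝ), (Φ s t).IsSymm)
    (hΦt : ∀ s ∈ Set.Icc (0:ℝ) ℓ, ∀ t ∈ Set.Ici (0:ℝ), ∀ i j,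
      HasDerivWithinAt (fun τ => Φ s τ i j) (Φt s t i j) (Set.Ici 0) t)
    (hΦc : ContinuousOn (fun z : ℝ × ℝ => (Φ z.1 z.2, Φt z.1 z.2)) (Set.Icc 0 ℓ ×ˢ Set.Ici 0))
    (hΨc : ContinuousOn (fun z : ℝ × ℝ => Ψ z.1 z.2) (Set.Icc 0 ℓ ×ˢ Set.Ici 0))
    -- exponential decay of the perturbations
    (hΦdecay : ∀ t ∈ Set.Ici (0:ℝ), ∀ s ∈ Set.Icc (0:ℝ) ℓ,
      opNorm (Φ s t) + opNorm (Φt s t) ≤ M * Real.exp (-β * t))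
    (hΨdecay : ∀ t ∈ Set.Ici (0:ℝ),
      L2vnorm ℓ (fun s => Ψ s t) ≤ M * Real.exp (-β * t))
    -- uniform ellipticity: K_q + Φ ⪰ μI
    (hell : ∀ s ∈ Set.Icc (0:ℝ) ℓ, ∀ t ∈ Set.Ici (0:ℝ),
      (Kq s + Φ s t - μ • (1 : Matrix (Fin 2) (Fin 2) ℝ)).PosSemidef)
    -- p̃ is a C² solution
    (p ps pt pst ptt q : ℝ → ℝ → Fin 2 → ℝ)
    (hps : ∀ t ∈ Set.Ici (0:ℝ), ∀ s ∈ Set.Icc (0:ℝ) ℓ,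
      HasDerivWithinAt (fun x => p x t) (ps s t) (Set.Icc 0 ℓ) s)
    (hpt : ∀ t ∈ Set.Ici (0:ℝ), ∀ s ∈ Set.Icc (0:ℝ) ℓ,
      HasDerivWithinAt (fun τ => p s τ) (pt s t) (Set.Ici 0) t)
    (hpst : ∀ t ∈ Set.Ici (0:ℝ), ∀ s ∈ Set.Icc (0:ℝ) ℓ,
      HasDerivWithinAt (fun τ => ps s τ) (pst s t) (Set.Ici 0) t)
    (hpts : ∀ t ∈ Set.Ici (0:ℝ), ∀ s ∈ Set.Icc (0:ℝ) ℓ,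
      HasDerivWithinAt (fun x => pt x t) (pst s t) (Set.Icc 0 ℓ) s)
    (hptt : ∀ t ∈ Set.Ici (0:ℝ), ∀ s ∈ Set.Icc (0:ℝ) ℓ,
      HasDerivWithinAt (fun τ => pt s τ) (ptt s t) (Set.Ici 0) t)
    -- `q = ((K_q + Φ)p̃_s)_s`
    (hq : ∀ t ∈ Set.Ici (0:ℝ), ∀ s ∈ Set.Icc (0:ℝ) ℓ,
      HasDerivWithinAt (fun x => (Kq x + Φ x t) *ᵥ ps x t) (q s t) (Set.Icc 0 ℓ) s)
    (hcont : ContinuousOn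
      (fun z : ℝ × ℝ => (p z.1 z.2, ps z.1 z.2, pt z.1 z.2, pst z.1 z.2, ptt z.1 z.2, q z.1 z.2))
      (Set.Icc 0 ℓ ×ˢ Set.Ici 0))
    -- the PDE
    (hpde : ∀ t ∈ Set.Ici (0:ℝ), ∀ s ∈ Set.Icc (0:ℝ) ℓ,
      ptt s t = q s t - (Kv s t) *ᵥ pt s t - (Kp s) *ᵥ p s t + Ψ s t)
    -- boundary conditions
    (hbc0 : ∀ t ∈ Set.Ici (0:ℝ), p 0 t = 0)
    (hbcl : ∀ t ∈ Set.Ici (0:ℝ), ps ℓ t = 0) :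
    ∃ C > (0:ℝ), ∃ lam > (0:ℝ), ∀ t ∈ Set.Ici (0:ℝ),
      L2vnorm ℓ (fun s => p s t) + L2vnorm ℓ (fun s => pt s t) + L2vnorm ℓ (fun s => ps s t)
        ≤ C * Real.exp (-lam * t) := by
  have hℓ0 := hℓ.le
  have hκ' : 0 < κ' := hκ.trans_le hκκ'
  set P : ℝ := 4 * ℓ ^ 2 / μ with hPdef
  have hP : 0 < P := by positivity
  obtain ⟨ε, hε, hε2, hεP2, hεκP, hεκ⟩ : ∃ ε > 0, ε ≤ 1 / 2 ∧ ε * P ≤ 1 / 2 ∧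
      2 * ε * κ' * P ≤ 1 ∧ ε ≤ κ / 8 := by
    refine ⟨min (min (1 / 2) (1 / (2 * P))) (min (1 / (2 * κ' * P)) (κ / 8)), by positivity,
      (min_le_left _ _).trans (min_le_left _ _), ?_, ?_,
      (min_le_right _ _).trans (min_le_right _ _)⟩
    · rw [← le_div_iff₀ hP, div_div]
      exact (min_le_left _ _).trans (min_le_right _ _)
    · have := (min_le_right (min (1 / 2) (1 / (2 * P))) _).trans
        (min_le_left (1 / (2 * κ' * P)) (κ / 8))
      rw [le_div_iff₀ (by positivity)] at this
      linarith
  -- continuity of all data on the strip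
  have cp : ContinuousOn (fun z : ℝ × ℝ => p z.1 z.2) (Icc 0 ℓ ×ˢ Ici 0) := hcont.fst
  have cps : ContinuousOn (fun z : ℝ × ℝ => ps z.1 z.2) (Icc 0 ℓ ×ˢ Ici 0) := hcont.snd.fst
  have cpt : ContinuousOn (fun z : ℝ × ℝ => pt z.1 z.2) (Icc 0 ℓ ×ˢ Ici 0) := hcont.snd.snd.fst
  have cpst : ContinuousOn (fun z : ℝ × ℝ => pst z.1 z.2) (Icc 0 ℓ ×ˢ Ici 0) :=
    hcont.snd.snd.snd.fst
  have cptt : ContinuousOn (fun z : ℝ × ℝ => ptt z.1 z.2) (Icc 0 ℓ ×ˢ Ici 0) :=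
    hcont.snd.snd.snd.snd.fst
  have cq : ContinuousOn (fun z : ℝ × ℝ => q z.1 z.2) (Icc 0 ℓ ×ˢ Ici 0) :=
    hcont.snd.snd.snd.snd.snd
  have cΦt : ContinuousOn (fun z : ℝ × ℝ => Φt z.1 z.2) (Icc 0 ℓ ×ˢ Ici 0) := hΦc.snd
  have cA : ContinuousOn (fun z : ℝ × ℝ => Kq z.1 + Φ z.1 z.2) (Icc 0 ℓ ×ˢ Ici 0) := by
    have : ContinuousOn Kq (Icc 0 ℓ) := continuousOn_pi.2 fun i => continuousOn_pi.2 fun j =>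
      fun s hs => (hKq' s hs i j).continuousWithinAt
    exact (this.comp continuousOn_fst fun z hz => hz.1).add hΦc.fst
  have cKp : ContinuousOn (fun z : ℝ × ℝ => Kp z.1) (Icc 0 ℓ ×ˢ Ici 0) :=
    hKpc.comp continuousOn_fst fun z hz => hz.1
  -- the energy density, its perturbation, the time derivative, and the null Lagrangians
  set e₀ : ℝ → ℝ → ℝ := fun s t => 1 / 2 * (pt s t ⬝ᵥ pt s t + ps s t ⬝ᵥ (Kq s + Φ s t) *ᵥ ps s t
    + p s t ⬝ᵥ Kp s *ᵥ p s t) with he₀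
  set e : ℝ → ℝ → ℝ := fun s t => e₀ s t + ε * (p s t ⬝ᵥ pt s t) with he
  set e' : ℝ → ℝ → ℝ := fun s t =>
    1 / 2 * ((ptt s t ⬝ᵥ pt s t + pt s t ⬝ᵥ ptt s t)
        + (pst s t ⬝ᵥ (Kq s + Φ s t) *ᵥ ps s t
          + ps s t ⬝ᵥ (Φt s t *ᵥ ps s t + (Kq s + Φ s t) *ᵥ pst s t))
        + (pt s t ⬝ᵥ Kp s *ᵥ p s t + p s t ⬝ᵥ Kp s *ᵥ pt s t))
      + ε * (pt s t ⬝ᵥ pt s t + p s t ⬝ᵥ ptt s t) with he'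
  set D : ℝ → ℝ → ℝ := fun s t =>
    p s t ⬝ᵥ p s t + (s - ℓ) * (ps s t ⬝ᵥ p s t + p s t ⬝ᵥ ps s t) with hD
  set F : ℝ → ℝ → ℝ := fun s t => (pst s t + ε • ps s t) ⬝ᵥ (Kq s + Φ s t) *ᵥ ps s t
    + (pt s t + ε • p s t) ⬝ᵥ q s t with hF
  have ce₀ : ContinuousOn (fun z : ℝ × ℝ => e₀ z.1 z.2) (Icc 0 ℓ ×ˢ Ici 0) :=
    (((cpt.dotProduct_fin_two cpt).add (cps.dotProduct_fin_two (cA.mulVec_fin_two cps))).add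
      (cp.dotProduct_fin_two (cKp.mulVec_fin_two cp))).const_mul _
  have ce : ContinuousOn (fun z : ℝ × ℝ => e z.1 z.2) (Icc 0 ℓ ×ˢ Ici 0) :=
    ce₀.add ((cp.dotProduct_fin_two cpt).const_mul _)
  have ce' : ContinuousOn (fun z : ℝ × ℝ => e' z.1 z.2) (Icc 0 ℓ ×ˢ Ici 0) :=
    (((((cptt.dotProduct_fin_two cpt).add (cpt.dotProduct_fin_two cptt)).add
      ((cpst.dotProduct_fin_two (cA.mulVec_fin_two cps)).add (cps.dotProduct_fin_two
        ((cΦt.mulVec_fin_two cps).add (cA.mulVec_fin_two cpst))))).add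
      ((cpt.dotProduct_fin_two (cKp.mulVec_fin_two cp)).add
        (cp.dotProduct_fin_two (cKp.mulVec_fin_two cpt)))).const_mul _).add
      (((cpt.dotProduct_fin_two cpt).add (cp.dotProduct_fin_two cptt)).const_mul _)
  have cD : ContinuousOn (fun z : ℝ × ℝ => D z.1 z.2) (Icc 0 ℓ ×ˢ Ici 0) :=
    (cp.dotProduct_fin_two cp).add ((continuousOn_fst.sub continuousOn_const).mul
      ((cps.dotProduct_fin_two cp).add (cp.dotProduct_fin_two cps)))
  have cF : ContinuousOn (fun z : ℝ × ℝ => F z.1 z.2) (Icc 0 ℓ ×ˢ Ici 0) :=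
    ((cpst.add (cps.const_smul ε)).dotProduct_fin_two (cA.mulVec_fin_two cps)).add
      ((cpt.add (cp.const_smul ε)).dotProduct_fin_two cq)
  have cψ : ContinuousOn (fun z : ℝ × ℝ => Ψ z.1 z.2 ⬝ᵥ Ψ z.1 z.2) (Icc 0 ℓ ×ˢ Ici 0) :=
    hΨc.dotProduct_fin_two hΨc
  have hde : ∀ t ∈ Ici (0:ℝ), ∀ s ∈ Icc (0:ℝ) ℓ,
      HasDerivWithinAt (fun τ => e s τ) (e' s t) (Ici 0) t := by
    intro t ht s hs
    have h1 := hptt t ht s hs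
    have h2 := hpst t ht s hs
    have h3 := hpt t ht s hs
    have h4 := HasDerivWithinAt.mulVec_fin_two (A := fun τ => Kq s + Φ s τ) (A' := Φt s t)
      (fun i j => (hΦt s hs t ht i j).const_add (Kq s i j)) h2
    have h5 := HasDerivWithinAt.mulVec_fin_two (A := fun _ => Kp s) (A' := 0)
      (fun i j => hasDerivWithinAt_const t (Ici 0) (Kp s i j)) h3
    exact (((((h1.dotProduct_fin_two h1).add (h2.dotProduct_fin_two h4)).add
      (h3.dotProduct_fin_two h5)).const_mul (1 / 2)).add
      ((h3.dotProduct_fin_two h1).const_mul ε)).congr_deriv (by simp [he'])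
  have hii : ∀ {f : ℝ → ℝ → ℝ}, ContinuousOn (fun z : ℝ × ℝ => f z.1 z.2) (Icc 0 ℓ ×ˢ Ici 0) →
      ∀ t, 0 ≤ t → IntervalIntegrable (fun s => f s t) volume 0 ℓ := fun hf t ht =>
    (hf.slice_strip ht).intervalIntegrable_of_Icc hℓ0
  have hD0 : ∀ t, 0 ≤ t → ∫ s in (0:ℝ)..ℓ, D s t = 0 := fun t ht => by
    refine integral_eq_zero_of_hasDerivWithinAt_Icc hℓ0
      (f := fun s => (s - ℓ) * (p s t ⬝ᵥ p s t)) (fun s hs => ?_) (cD.slice_strip ht) ?_ ?_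
    · have h1 := hps t ht s hs
      exact (((hasDerivWithinAt_id s _).sub_const ℓ).mul (h1.dotProduct_fin_two h1)).congr_deriv
        (by simp [hD])
    · simp [hbc0 t ht]
    · simp
  have hpt0 : ∀ t, 0 ≤ t → pt 0 t = 0 := fun t ht => by
    have h1 := hpt t ht 0 (left_mem_Icc.2 hℓ0)
    have h2 : HasDerivWithinAt (fun τ => p 0 τ) 0 (Ici 0) t :=
      (hasDerivWithinAt_const t (Ici 0) (0 : Fin 2 → ℝ)).congr (fun τ hτ => hbc0 τ hτ) (hbc0 t ht)
    exact (uniqueDiffOn_Ici 0 t ht).eq_deriv _ h1 h2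
  have hF0 : ∀ t, 0 ≤ t → ∫ s in (0:ℝ)..ℓ, F s t = 0 := fun t ht => by
    refine integral_eq_zero_of_hasDerivWithinAt_Icc hℓ0
      (f := fun s => (pt s t + ε • p s t) ⬝ᵥ (Kq s + Φ s t) *ᵥ ps s t) (fun s hs => ?_)
      (cF.slice_strip ht) ?_ ?_
    · exact ((hpts t ht s hs).add ((hps t ht s hs).const_smul ε)).dotProduct_fin_two
        (hq t ht s hs)
    · simp [hbc0 t ht, hpt0 t ht]
    · simp [hbcl t ht]
  -- coercivity
  have hr : ∀ t, 0 ≤ t → ∀ s ∈ Icc (0:ℝ) ℓ,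
      μ * (ps s t ⬝ᵥ ps s t) ≤ ps s t ⬝ᵥ (Kq s + Φ s t) *ᵥ ps s t := fun t ht s hs =>
    smul_one_le_dotProduct_mulVec (hell s hs t ht) _
  have hb0 : ∀ t, 0 ≤ t → ∀ s ∈ Icc (0:ℝ) ℓ,
      0 ≤ ps s t ⬝ᵥ (Kq s + Φ s t) *ᵥ ps s t := fun t ht s hs =>
    (mul_nonneg hμ.le (dotProduct_self_nonneg_real _)).trans (hr t ht s hs)
  have hc0 : ∀ t, 0 ≤ t → ∀ s ∈ Icc (0:ℝ) ℓ, 0 ≤ p s t ⬝ᵥ Kp s *ᵥ p s t := fun t ht s hs =>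
    (hKppd s hs).posSemidef.dotProduct_mulVec_self_nonneg _
  have hu : ∀ t, 0 ≤ t → ∀ s ∈ Icc (0:ℝ) ℓ, p s t ⬝ᵥ p s t
      ≤ 2 * D s t + P * (ps s t ⬝ᵥ (Kq s + Φ s t) *ᵥ ps s t) := fun t ht s hs => by
    have h1 := poincare_pointwise (p s t) (ps s t) hs.1 hs.2
    have h2 := mul_le_mul_of_nonneg_left (hr t ht s hs) hP.le
    have h3 : P * (μ * (ps s t ⬝ᵥ ps s t)) = 4 * ℓ ^ 2 * (ps s t ⬝ᵥ ps s t) := by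
      rw [hPdef]; field_simp
    linarith
  set V : ℝ → ℝ := fun t => ∫ s in (0:ℝ)..ℓ, e s t with hV
  set E : ℝ → ℝ := fun t => ∫ s in (0:ℝ)..ℓ, e₀ s t with hE
  have hE0 : ∀ t, 0 ≤ t → 0 ≤ E t := fun t ht =>
    intervalIntegral.integral_nonneg hℓ0 fun s hs => by
      have := hb0 t ht s hs
      have := hc0 t ht s hs
      have := dotProduct_self_nonneg_real (pt s t)
      simp only [he₀]; positivity
  have hequiv := fun t (ht : 0 ≤ t) s (hs : s ∈ Icc (0:ℝ) ℓ) =>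
    energy_equiv_pointwise (v := pt s t) (hb0 t ht s hs) (hc0 t ht s hs) hε hε2 hεP2 (hu t ht s hs)
  have hEV : ∀ t, 0 ≤ t → E t ≤ 2 * V t := fun t ht => by
    have h := intervalIntegral.integral_mono_on hℓ0 ((hii ce₀ t ht).const_mul (1 / 2))
      ((hii ce t ht).add ((hii cD t ht).const_mul ε)) fun s hs => (hequiv t ht s hs).1
    rw [intervalIntegral.integral_add (hii ce t ht) ((hii cD t ht).const_mul ε)] at h
    simp only [intervalIntegral.integral_const_mul, hD0 t ht] at h
    simp only [hE, hV]
    linarith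
  have hVE : ∀ t, 0 ≤ t → V t ≤ 3 / 2 * E t := fun t ht => by
    have h := intervalIntegral.integral_mono_on hℓ0 (hii ce t ht)
      (((hii ce₀ t ht).const_mul (3 / 2)).add ((hii cD t ht).const_mul ε))
      fun s hs => (hequiv t ht s hs).2
    rw [intervalIntegral.integral_add ((hii ce₀ t ht).const_mul (3 / 2))
      ((hii cD t ht).const_mul ε)] at h
    simp only [intervalIntegral.integral_const_mul, hD0 t ht] at h
    simp only [hE, hV]
    linarith
  have hψ : ∀ t, 0 ≤ t → ∫ s in (0:ℝ)..ℓ, Ψ s t ⬝ᵥ Ψ s t ≤ M ^ 2 * Real.exp (-β * t) :=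
    fun t ht => by
      have h := hΨdecay t ht
      simp only [L2vnorm, ← dotProduct_self_eq_sq_add_sq] at h
      have h1 := (Real.sqrt_le_left (by positivity)).1 h
      have h2 : Real.exp (-β * t) ≤ 1 := Real.exp_le_one_iff.2 (by
        have := mul_nonneg hβ.le ht; linarith)
      have h3 : Real.exp (-β * t) ^ 2 ≤ Real.exp (-β * t) := by
        nlinarith [Real.exp_pos (-β * t)]
      rw [mul_pow] at h1
      exact h1.trans (mul_le_mul_of_nonneg_left h3 (by positivity))
  have hdiss : ∀ t, 0 ≤ t → ∫ s in (0:ℝ)..ℓ, e' s t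
      ≤ (-ε + M / μ * Real.exp (-β * t)) * E t
        + (2 / κ + ε * P) * ∫ s in (0:ℝ)..ℓ, Ψ s t ⬝ᵥ Ψ s t := fun t ht => by
    have i1 := (hii ce₀ t ht).const_mul (-ε + M / μ * Real.exp (-β * t))
    have i2 := (hii (f := fun s t => Ψ s t ⬝ᵥ Ψ s t) cψ t ht).const_mul (2 / κ + ε * P)
    have i3 := (hii cF t ht).add ((hii cD t ht).const_mul (ε / P))
    have h := intervalIntegral.integral_mono_on hℓ0 (hii ce' t ht) ((i1.add i2).add i3)
      fun s hs => by
        have hB : ps s t ⬝ᵥ Φt s t *ᵥ ps s t ≤ M / μ * Real.exp (-β * t)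
            * (ps s t ⬝ᵥ (Kq s + Φ s t) *ᵥ ps s t) := by
          have h1 : opNorm (Φt s t) ≤ M * Real.exp (-β * t) := by
            have h2 : 0 ≤ opNorm (Φ s t) := norm_nonneg _
            linarith [hΦdecay t ht s hs]
          calc _ ≤ opNorm (Φt s t) * (ps s t ⬝ᵥ ps s t) := dotProduct_mulVec_le_opNorm _ _
            _ ≤ M * Real.exp (-β * t) * (ps s t ⬝ᵥ ps s t) :=
              mul_le_mul_of_nonneg_right h1 (dotProduct_self_nonneg_real _)
            _ = M / μ * Real.exp (-β * t) * (μ * (ps s t ⬝ᵥ ps s t)) := by field_simp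
            _ ≤ _ := mul_le_mul_of_nonneg_left (hr t ht s hs) (by positivity)
        exact energy_dissipation_pointwise hκ hκ' hP hε hεκ hεκP
          ((hKqsym s hs).add (hΦsym s hs t ht)) (hKpsym s hs) (hKvsym s hs t ht)
          (smul_one_le_dotProduct_mulVec (hKvlb s hs t ht))
          (dotProduct_mulVec_le_smul_one (hKvub s hs t ht)) (hc0 t ht s hs) hB (by positivity)
          (hu t ht s hs) (hpde t ht s hs)
    rw [intervalIntegral.integral_add (i1.add i2) i3, intervalIntegral.integral_add i1 i2,
      intervalIntegral.integral_add (hii cF t ht) ((hii cD t ht).const_mul (ε / P))] at h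
    simp only [intervalIntegral.integral_const_mul, hD0 t ht, hF0 t ht] at h
    simp only [hE]
    linarith
  obtain ⟨C, hC, lam, hlam, hdecay⟩ := exists_exp_decay_of_deriv_le (V := V)
    (V' := fun t => ∫ s in (0:ℝ)..ℓ, e' s t) (a := 2 / 3 * ε) (b := 2 * (M / μ))
    (c := (2 / κ + ε * P) * M ^ 2) (β := β) (by positivity) (by positivity) (by positivity) hβ
    (ce.intervalIntegral_strip hℓ0) (fun t ht => by linarith [hE0 t ht, hEV t ht])
    (fun t ht => hasDerivAt_intervalIntegral_strip hℓ0 ce ce' hde ht)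
    (fun t ht => by
      have h1 := hdiss t ht.le
      have h2 := mul_le_mul_of_nonneg_left (hVE t ht.le) hε.le
      have h3 := mul_le_mul_of_nonneg_left (hEV t ht.le)
        (show 0 ≤ M / μ * Real.exp (-β * t) by positivity)
      have h4 := mul_le_mul_of_nonneg_left (hψ t ht.le) (show 0 ≤ 2 / κ + ε * P by positivity)
      linarith)
  have hsqrt : ∀ (t I k : ℝ), 0 ≤ t → 0 ≤ k → I ≤ k * E t →
      √I ≤ √(2 * k * C) * Real.exp (-(lam / 2) * t) := fun t I k ht hk hI => by
    have h1 : I ≤ 2 * k * C * Real.exp (-lam * t) := by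
      have := mul_le_mul_of_nonneg_left ((hEV t ht).trans
        (mul_le_mul_of_nonneg_left (hdecay t ht) zero_le_two)) hk
      linarith
    refine (Real.sqrt_le_sqrt h1).trans_eq ?_
    rw [Real.sqrt_mul (by positivity), ← Real.exp_half]
    ring_nf
  refine ⟨√(2 * (2 * P) * C) + √(2 * 2 * C) + √(2 * (2 / μ) * C), by positivity, lam / 2,
    by positivity, fun t ht => ?_⟩
  replace ht : 0 ≤ t := ht
  have hk : ∀ (f : ℝ → ℝ → ℝ) (x k : ℝ),
      ContinuousOn (fun z : ℝ × ℝ => f z.1 z.2) (Icc 0 ℓ ×ˢ Ici 0) →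
      (∀ s ∈ Icc (0:ℝ) ℓ, f s t ≤ k * e₀ s t + x * D s t) →
      ∫ s in (0:ℝ)..ℓ, f s t ≤ k * E t := fun f x k hf hle => by
    have h := intervalIntegral.integral_mono_on hℓ0 (hii hf t ht)
      (((hii ce₀ t ht).const_mul k).add ((hii cD t ht).const_mul x)) hle
    rw [intervalIntegral.integral_add ((hii ce₀ t ht).const_mul k)
      ((hii cD t ht).const_mul x)] at h
    simp only [intervalIntegral.integral_const_mul, hD0 t ht] at h
    simp only [hE]
    linarith
  simp only [L2vnorm, ← dotProduct_self_eq_sq_add_sq, add_mul]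
  refine add_le_add (add_le_add ?_ ?_) ?_
  · refine hsqrt t _ (2 * P) ht (by positivity)
      (hk (fun s t => p s t ⬝ᵥ p s t) 2 _ (cp.dotProduct_fin_two cp) fun s hs => ?_)
    have h1 := hu t ht s hs
    have h2 := mul_nonneg hP.le (dotProduct_self_nonneg_real (pt s t))
    have h3 := mul_nonneg hP.le (hc0 t ht s hs)
    simp only [he₀]
    linarith
  · refine hsqrt t _ 2 ht (by positivity)
      (hk (fun s t => pt s t ⬝ᵥ pt s t) 0 _ (cpt.dotProduct_fin_two cpt) fun s hs => ?_)
    have h1 := hb0 t ht s hs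
    have h2 := hc0 t ht s hs
    simp only [he₀]
    linarith
  · refine hsqrt t _ (2 / μ) ht (by positivity)
      (hk (fun s t => ps s t ⬝ᵥ ps s t) 0 _ (cps.dotProduct_fin_two cps) fun s hs => ?_)
    have h1 := hr t ht s hs
    have h2 := hc0 t ht s hs
    have h3 := dotProduct_self_nonneg_real (pt s t)
    rw [zero_mul, add_zero, div_mul_eq_mul_div, le_div_iff₀ hμ]
    simp only [he₀]
    linarith
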